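/- Let X be a nonempty set, let (Q,≼_Q) be a partially ordered set with smallest element q₀, and let d : X² → Q be a Q-pseudoultrametric (respectively, a Q-ultrametric) on X. Then: (i) if |d(X²)| ≤ 2^ℵ₀ holds, then d is combinatorially similar to a pseudometric (respectively, to a metric); (ii) if |d(X²)| ≤ ℵ₀ holds, then d is combinatorially similar to a pseudoultrametric (respectively, to an ultrametric). -/

import Mathlib

namespace CombSimPaper

/-- The range `Φ(X²)` of a mapping `Φ` with domain `X²`. -/
def rng {X A : Type*} (Φ : X → X → A) : Set A := {a | ∃ x y, Φ x y = a}

/-- `Φ` is strongly consistent with the binary relation `R` on `X`. -/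
def StronglyConsistent {X A : Type*} (Φ : X → X → A) (R : X → X → Prop) : Prop :=
  ∀ x₁ x₂ x₃ x₄, R x₁ x₂ → R x₃ x₄ → Φ x₁ x₃ = Φ x₂ x₄

/-- The fiber `Φ⁻¹(a)`, viewed as a binary relation on `X`. -/
def fiber {X A : Type*} (Φ : X → X → A) (a : A) : X → X → Prop :=
  fun x y => Φ x y = a

/-- `Φ` is `a₀`-coherent: the fiber `Φ⁻¹(a₀)` is an equivalence relation and `Φ` is
strongly consistent with it. -/
def Coherent {X A : Type*} (Φ : X → X → A) (a₀ : A) : Prop :=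
  Equivalence (fiber Φ a₀) ∧ StronglyConsistent Φ (fiber Φ a₀)

/-- `g : Y → X` is a combinatorial similarity for the mappings `Ψ` (with domain `Y²`)
and `Φ` (with domain `X²`). -/
def CombSimWith {X Y A B : Type*} (Φ : X → X → A) (Ψ : Y → Y → B) (g : Y → X) : Prop :=
  Function.Bijective g ∧ ∃ f : A → B, Set.BijOn f (rng Φ) (rng Ψ) ∧
    ∀ x y : Y, Ψ x y = f (Φ (g x) (g y))

/-- `Φ` is combinatorially similar to `Ψ`. -/
def CombSim {X Y A B : Type*} (Φ : X → X → A) (Ψ : Y → Y → B) : Prop :=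
  ∃ g : Y → X, CombSimWith Φ Ψ g

/-- Some permutation `⟨x_{i₁}, x_{i₂}, x_{i₃}⟩` of the triple `⟨x₁, x₂, x₃⟩`
satisfies the ternary predicate `P`. -/
def PermTriple {X : Type*} (P : X → X → X → Prop) (x₁ x₂ x₃ : X) : Prop :=
  ∃ σ : Equiv.Perm (Fin 3),
    P (![x₁, x₂, x₃] (σ 0)) (![x₁, x₂, x₃] (σ 1)) (![x₁, x₂, x₃] (σ 2))

/-- `d : X² → Q` is a `≼`-pseudoultrametric (for the order `le` with smallest element `q₀`). -/
def QPseudoUltra {X Q : Type*} (le : Q → Q → Prop) (q₀ : Q) (d : X → X → Q) : Prop :=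
  (∀ x y, d x y = d y x) ∧ (∀ x, d x x = q₀) ∧
  ∀ x₁ x₂ x₃, PermTriple (fun a b c => le (d a c) (d a b) ∧ d a b = d b c) x₁ x₂ x₃

/-- `d : X² → Q` is a `≼`-ultrametric. -/
def QUltra {X Q : Type*} (le : Q → Q → Prop) (q₀ : Q) (d : X → X → Q) : Prop :=
  QPseudoUltra le q₀ d ∧ ∀ x y, d x y = q₀ ↔ x = y

/-- The binary relation `u_Φ` on the range of `Φ`. -/
def uRel {X A : Type*} (Φ : X → X → A) : A → A → Prop :=
  fun y₁ y₂ => ∃ x₁ x₂ x₃, y₁ = Φ x₁ x₃ ∧ y₂ = Φ x₁ x₂ ∧ Φ x₁ x₂ = Φ x₂ x₃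

/-- The binary relation `≼_Φ := u_Φᵗ ∪ Δ_{Φ(X²)}`. -/
def lePhi {X A : Type*} (Φ : X → X → A) : A → A → Prop :=
  fun a b => Relation.TransGen (uRel Φ) a b ∨ (a = b ∧ a ∈ rng Φ)

/-- `r` is a partial order on the subset `S`. -/
def IsPartialOrderOn {A : Type*} (S : Set A) (r : A → A → Prop) : Prop :=
  (∀ a ∈ S, r a a) ∧
  (∀ a b c, a ∈ S → b ∈ S → c ∈ S → r a b → r b c → r a c) ∧
  (∀ a b, a ∈ S → b ∈ S → r a b → r b a → a = b)

/-- `r` is a linear (total) order on the subset `S`. -/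
def IsLinearOrderOn {A : Type*} (S : Set A) (r : A → A → Prop) : Prop :=
  IsPartialOrderOn S r ∧ ∀ a b, a ∈ S → b ∈ S → (r a b ∨ r b a)

/-- A (real-valued, nonnegative) pseudometric. -/
def IsPseudoMetric {X : Type*} (d : X → X → ℝ) : Prop :=
  (∀ x y, 0 ≤ d x y) ∧ (∀ x y, d x y = d y x) ∧ (∀ x, d x x = 0) ∧
  ∀ x y z, d x y ≤ d x z + d z y

/-- A (real-valued) metric. -/
def IsMetric {X : Type*} (d : X → X → ℝ) : Prop :=
  IsPseudoMetric d ∧ ∀ x y, d x y = 0 ↔ x = y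

/-- A (real-valued, nonnegative) pseudoultrametric. -/
def IsPseudoUltrametric {X : Type*} (d : X → X → ℝ) : Prop :=
  (∀ x y, 0 ≤ d x y) ∧ (∀ x y, d x y = d y x) ∧ (∀ x, d x x = 0) ∧
  ∀ x y z, d x y ≤ max (d x z) (d z y)

/-- A (real-valued) ultrametric. -/
def IsUltrametric {X : Type*} (d : X → X → ℝ) : Prop :=
  IsPseudoUltrametric d ∧ ∀ x y, d x y = 0 ↔ x = y

/-- `d` is a `le`-pseudoultrametric, where `le` is a partial order on `Q` having a smallest
element. -/
def IsPseudoUltraFor {X Q : Type*} (d : X → X → Q) (le : Q → Q → Prop) : Prop :=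
  IsPartialOrder Q le ∧ ∃ q₀, (∀ q, le q₀ q) ∧ QPseudoUltra le q₀ d

/-- `g : X₁ → X₂` is a weak similarity for the `Q₁`-pseudoultrametric `d₁` and the
`Q₂`-pseudoultrametric `d₂`: `g` is a bijection and there is an order isomorphism
`f` of the subposet `d₂(X₂²)` of `Q₂` onto the subposet `d₁(X₁²)` of `Q₁` with
`d₁(x, y) = f (d₂ (g x) (g y))`. -/
def WeakSim {X₁ X₂ Q₁ Q₂ : Type*} (le₁ : Q₁ → Q₁ → Prop) (le₂ : Q₂ → Q₂ → Prop)
    (d₁ : X₁ → X₁ → Q₁) (d₂ : X₂ → X₂ → Q₂) (g : X₁ → X₂) : Prop :=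
  Function.Bijective g ∧ ∃ f : Q₂ → Q₁,
    Set.BijOn f (rng d₂) (rng d₁) ∧
    (∀ a ∈ rng d₂, ∀ b ∈ rng d₂, (le₂ a b ↔ le₁ (f a) (f b))) ∧
    ∀ x y, d₁ x y = f (d₂ (g x) (g y))

/-- The subset `S`, ordered by `r`, is order-isomorphic to a subposet of `(ℝ⁺, ≤)`. -/
def EmbedsInRPlus {A : Type*} (S : Set A) (r : A → A → Prop) : Prop :=
  ∃ e : A → ℝ, (∀ a ∈ S, 0 ≤ e a) ∧ Set.InjOn e S ∧
    ∀ a ∈ S, ∀ b ∈ S, (r a b ↔ e a ≤ e b)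

universe u v

theorem exists_injOn_Icc_of_mk_le_continuum {Q : Type*} {S : Set Q} (q₀ : Q)
    (hS : Cardinal.mk S ≤ Cardinal.continuum) :
    ∃ f : Q → ℝ, Set.InjOn f S ∧ f q₀ = 0 ∧
      ∀ q ∈ S, q ≠ q₀ → f q ∈ Set.Icc (1 : ℝ) 2 := by
  classical
  obtain ⟨e⟩ : Nonempty (S ↪ Set.Icc (1 : ℝ) 2) := by
    rw [← Cardinal.lift_mk_le', Cardinal.mk_Icc_real one_lt_two, Cardinal.lift_continuum,
      Cardinal.lift_le_continuum]
    exact hS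
  let f : Q → ℝ := fun q => if h : q ∈ S ∧ q ≠ q₀ then e ⟨q, h.1⟩ else 0
  have hf : ∀ q (hq : q ∈ S), q ≠ q₀ → f q = e ⟨q, hq⟩ := fun q hq h => dif_pos ⟨hq, h⟩
  have hf₀ : f q₀ = 0 := dif_neg fun h => h.2 rfl
  have hIcc : ∀ q ∈ S, q ≠ q₀ → f q ∈ Set.Icc (1 : ℝ) 2 := fun q hq h => by
    rw [hf q hq h]
    exact (e _).2
  refine ⟨f, fun a ha b hb hab => ?_, hf₀, hIcc⟩
  by_cases ha₀ : a = q₀ <;> by_cases hb₀ : b = q₀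
  · rw [ha₀, hb₀]
  · have := (hIcc b hb hb₀).1
    rw [← hab, ha₀, hf₀] at this
    linarith
  · have := (hIcc a ha ha₀).1
    rw [hab, hb₀, hf₀] at this
    linarith
  · rw [hf a ha ha₀, hf b hb hb₀] at hab
    exact congrArg Subtype.val (e.injective (Subtype.ext hab))

theorem exists_injOn_monotone_of_countable {Q : Type*} {le : Q → Q → Prop}
    (hle : IsPartialOrder Q le) {S : Set Q} (hS : S.Countable) (q₀ : Q) :
    ∃ f : Q → ℝ, Set.InjOn f S ∧ f q₀ = 0 ∧ ∀ a ∈ S, ∀ b ∈ S, le a b → f a ≤ f b := by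
  classical
  let _ : PartialOrder S :=
    { le := fun a b => le a b
      le_refl := fun a => hle.refl a
      le_trans := fun a b c => hle.trans a b c
      le_antisymm := fun a b hab hba => Subtype.ext (hle.antisymm _ _ hab hba) }
  have : Countable (LinearExtension S) := hS.to_subtype
  obtain ⟨e⟩ := Order.embedding_from_countable_to_dense (α := LinearExtension S) (β := ℝ)
  let g : Q → ℝ := fun q => if h : q ∈ S then e (toLinearExtension ⟨q, h⟩) else 0
  have hg : ∀ q (hq : q ∈ S), g q = e (toLinearExtension ⟨q, hq⟩) := fun q hq => dif_pos hq
  refine ⟨fun q => g q - g q₀, fun a ha b hb hab => ?_, sub_self _, fun a ha b hb hab => ?_⟩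
  · have h := sub_left_injective hab
    rw [hg a ha, hg b hb] at h
    exact congrArg Subtype.val (show (⟨a, ha⟩ : S) = ⟨b, hb⟩ from e.injective h)
  · refine sub_le_sub_right ?_ _
    rw [hg a ha, hg b hb]
    exact e.monotone (toLinearExtension.monotone
      (show (⟨a, ha⟩ : S) ≤ ⟨b, hb⟩ from hab))

theorem QPseudoUltra.isosceles {X Q : Type*} {le : Q → Q → Prop} {q₀ : Q} {d : X → X → Q}
    (hd : QPseudoUltra le q₀ d) (x y z : X) :
    (d x y = d x z ∧ le (d z y) (d x y)) ∨ (d x y = d z y ∧ le (d x z) (d x y)) ∨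
      (d x z = d z y ∧ le (d x y) (d x z)) := by
  obtain ⟨hsymm, -, htri⟩ := hd
  obtain ⟨σ, h⟩ := htri x y z
  have h01 : σ 0 ≠ σ 1 := fun h => absurd (σ.injective h) (by decide)
  have h02 : σ 0 ≠ σ 2 := fun h => absurd (σ.injective h) (by decide)
  have h12 : σ 1 ≠ σ 2 := fun h => absurd (σ.injective h) (by decide)
  have hyx := hsymm y x
  have hzx := hsymm z x
  have hyz := hsymm y z
  generalize σ 0 = i at *
  generalize σ 1 = j at *
  generalize σ 2 = k at *
  fin_cases i <;> fin_cases j <;> fin_cases k <;> simp_all <;> grind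

theorem mem_rng {X A : Type*} (Φ : X → X → A) (x y : X) : Φ x y ∈ rng Φ := ⟨x, y, rfl⟩

theorem combSim_comp {X A B : Type*} {Φ : X → X → A} {f : A → B} (hf : Set.InjOn f (rng Φ)) :
    CombSim Φ fun x y => f (Φ x y) := by
  refine ⟨id, Function.bijective_id, f, ⟨?_, hf, ?_⟩, fun _ _ => rfl⟩
  · rintro _ ⟨x, y, rfl⟩
    exact ⟨x, y, rfl⟩
  · rintro _ ⟨x, y, rfl⟩
    exact ⟨Φ x y, ⟨x, y, rfl⟩, rfl⟩

theorem QPseudoUltra.isPseudoMetric_comp {X Q : Type*} {le : Q → Q → Prop}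
    (hle : IsPartialOrder Q le) {q₀ : Q} (hq₀ : ∀ q, le q₀ q) {d : X → X → Q}
    (hd : QPseudoUltra le q₀ d) {f : Q → ℝ} (hf₀ : f q₀ = 0)
    (hf : ∀ q ∈ rng d, q ≠ q₀ → f q ∈ Set.Icc (1 : ℝ) 2) :
    IsPseudoMetric fun x y => f (d x y) := by
  have hnonneg : ∀ x y, 0 ≤ f (d x y) := fun x y => by
    by_cases h : d x y = q₀
    · rw [h, hf₀]
    · exact zero_le_one.trans (hf _ (mem_rng d x y) h).1
  have hbot : ∀ q, le q q₀ → q = q₀ := fun q h => hle.antisymm _ _ h (hq₀ q)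
  refine ⟨hnonneg, fun x y => congrArg f (hd.1 x y),
    fun x => (congrArg f (hd.2.1 x)).trans hf₀, fun x y z => ?_⟩
  change f (d x y) ≤ f (d x z) + f (d z y)
  rcases hd.isosceles x y z with ⟨h, -⟩ | ⟨h, -⟩ | ⟨h, hxy⟩
  · rw [h]
    exact le_add_of_nonneg_right (hnonneg z y)
  · rw [h]
    exact le_add_of_nonneg_left (hnonneg x z)
  · by_cases hxz : d x z = q₀
    · rw [hxz] at hxy
      rw [hbot _ hxy, hf₀]
      exact add_nonneg (hnonneg x z) (hnonneg z y)
    · by_cases hxy₀ : d x y = q₀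
      · rw [hxy₀, hf₀]
        exact add_nonneg (hnonneg x z) (hnonneg z y)
      · have h₁ := (hf _ (mem_rng d x y) hxy₀).2
        have h₂ := (hf _ (mem_rng d x z) hxz).1
        rw [← h]
        linarith

theorem QPseudoUltra.isPseudoUltrametric_comp {X Q : Type*} {le : Q → Q → Prop}
    {q₀ : Q} (hq₀ : ∀ q, le q₀ q) {d : X → X → Q} (hd : QPseudoUltra le q₀ d) {f : Q → ℝ}
    (hf₀ : f q₀ = 0) (hf : ∀ a ∈ rng d, ∀ b ∈ rng d, le a b → f a ≤ f b) :
    IsPseudoUltrametric fun x y => f (d x y) := by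
  refine ⟨fun x y => ?_, fun x y => congrArg f (hd.1 x y),
    fun x => (congrArg f (hd.2.1 x)).trans hf₀, fun x y z => ?_⟩
  · exact hf₀.symm.le.trans (hf _ ⟨x, x, hd.2.1 x⟩ _ (mem_rng d x y) (hq₀ _))
  · rcases hd.isosceles x y z with ⟨h, -⟩ | ⟨h, -⟩ | ⟨-, h⟩
    · exact le_max_of_le_left (congrArg f h).le
    · exact le_max_of_le_right (congrArg f h).le
    · exact le_max_of_le_left (hf _ (mem_rng d x y) _ (mem_rng d x z) h)

theorem QUltra.comp_eq_zero_iff {X Q : Type*} {le : Q → Q → Prop} {q₀ : Q} {d : X → X → Q}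
    (hd : QUltra le q₀ d) {f : Q → ℝ} (hf : Set.InjOn f (rng d)) (hf₀ : f q₀ = 0) (x y : X) :
    f (d x y) = 0 ↔ x = y := by
  rw [← hd.2 x y, ← hf₀]
  exact hf.eq_iff (mem_rng d x y) ⟨x, x, hd.1.2.1 x⟩

/-- Corollary 3.17: a `Q`-pseudoultrametric (resp. `Q`-ultrametric) `d` is combinatorially
similar to a pseudometric (resp. metric) whenever `|d(X²)| ≤ 2^ℵ₀`, and to a
pseudoultrametric (resp. ultrametric) whenever `|d(X²)| ≤ ℵ₀`. -/
theorem statement6 {X : Type u} {Q : Type v} [Nonempty X]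
    (leQ : Q → Q → Prop) (q₀ : Q) (hpo : IsPartialOrder Q leQ) (hq₀ : ∀ q, leQ q₀ q)
    (d : X → X → Q) :
    (QPseudoUltra leQ q₀ d →
      (Cardinal.mk ↥(rng d) ≤ Cardinal.continuum →
        ∃ (Y : Type u) (_ : Nonempty Y) (ρ : Y → Y → ℝ), IsPseudoMetric ρ ∧ CombSim d ρ) ∧
      ((rng d).Countable →
        ∃ (Y : Type u) (_ : Nonempty Y) (ρ : Y → Y → ℝ),
          IsPseudoUltrametric ρ ∧ CombSim d ρ)) ∧
    (QUltra leQ q₀ d →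
      (Cardinal.mk ↥(rng d) ≤ Cardinal.continuum →
        ∃ (Y : Type u) (_ : Nonempty Y) (ρ : Y → Y → ℝ), IsMetric ρ ∧ CombSim d ρ) ∧
      ((rng d).Countable →
        ∃ (Y : Type u) (_ : Nonempty Y) (ρ : Y → Y → ℝ),
          IsUltrametric ρ ∧ CombSim d ρ)) := by
  refine ⟨fun hd => ⟨fun hc => ?_, fun hc => ?_⟩, fun hd => ⟨fun hc => ?_, fun hc => ?_⟩⟩
  · obtain ⟨f, hinj, hf₀, hf⟩ := exists_injOn_Icc_of_mk_le_continuum q₀ hc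
    exact ⟨X, ‹_›, _, hd.isPseudoMetric_comp hpo hq₀ hf₀ hf, combSim_comp hinj⟩
  · obtain ⟨f, hinj, hf₀, hf⟩ := exists_injOn_monotone_of_countable hpo hc q₀
    exact ⟨X, ‹_›, _, hd.isPseudoUltrametric_comp hq₀ hf₀ hf, combSim_comp hinj⟩
  · obtain ⟨f, hinj, hf₀, hf⟩ := exists_injOn_Icc_of_mk_le_continuum q₀ hc
    exact ⟨X, ‹_›, _, ⟨hd.1.isPseudoMetric_comp hpo hq₀ hf₀ hf, hd.comp_eq_zero_iff hinj hf₀⟩,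
      combSim_comp hinj⟩
  · obtain ⟨f, hinj, hf₀, hf⟩ := exists_injOn_monotone_of_countable hpo hc q₀
    exact ⟨X, ‹_›, _, ⟨hd.1.isPseudoUltrametric_comp hq₀ hf₀ hf, hd.comp_eq_zero_iff hinj hf₀⟩,
      combSim_comp hinj⟩

end CombSimPaper
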